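/- Let G be a finite connected graph and A, B disjoint, linked, saturated subsets of V(G) with V(G) \ (A ∪ B) = N(A ∪ B). Then A and B are separable by monophonic half-spaces if and only if the induced subgraph G[N(A ∪ B)] is cobipartite (its vertex set can be partitioned into two cliques, one of which may be empty). -/

import Mathlib

open Classical

variable {V : Type*}

namespace Paper

def mInterval (G : SimpleGraph V) (u v : V) : Set V :=
  {w | ∃ p : G.Walk u v, p.IsPath ∧ p.toSubgraph.IsInduced ∧ w ∈ p.support}

def MConvex (G : SimpleGraph V) (C : Set V) : Prop :=
  ∀ u ∈ C, ∀ v ∈ C, mInterval G u v ⊆ C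

def mHull (G : SimpleGraph V) (X : Set V) : Set V :=
  ⋂₀ {C | MConvex G C ∧ X ⊆ C}

def mIntervalSet (G : SimpleGraph V) (Z : Set V) : Set V :=
  ⋃ u ∈ Z, ⋃ v ∈ Z, mInterval G u v

def Sep (G : SimpleGraph V) (A B : Set V) : Prop :=
  ∃ H : Set V, MConvex G H ∧ MConvex G Hᶜ ∧ A ⊆ H ∧ B ⊆ Hᶜ

def nbhd (G : SimpleGraph V) (X : Set V) : Set V :=
  {v | v ∉ X ∧ ∃ x ∈ X, G.Adj x v}

def cnbhd (G : SimpleGraph V) (X : Set V) : Set V := X ∪ nbhd G X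

def front (G : SimpleGraph V) (X Y : Set V) : Set V := X ∩ cnbhd G Y

def IsClique (G : SimpleGraph V) (K : Set V) : Prop :=
  ∀ u ∈ K, ∀ v ∈ K, u ≠ v → G.Adj u v

def shadow (G : SimpleGraph V) (A B : Set V) : Set V :=
  {v | (mHull G (B ∪ {v}) ∩ A).Nonempty}

def Forbidden (G : SimpleGraph V) (A B X : Set V) : Prop :=
  X ⊆ (A ∪ B)ᶜ ∧ (mHull G X ∩ A).Nonempty ∧ (mHull G X ∩ B).Nonempty

def MFS (G : SimpleGraph V) (A B : Set V) : Set (Set V) :=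
  {X | Forbidden G A B X ∧ ∀ Y, Y ⊂ X → ¬ Forbidden G A B Y}

def presat (G : SimpleGraph V) (A B : Set V) : Set V :=
  mHull G (shadow G A B ∪ ⋃ X ∈ MFS G A B, ⋂ x ∈ X, mHull G (A ∪ {x}))

def Linked (G : SimpleGraph V) (A B : Set V) : Prop :=
  ∃ a ∈ A, ∃ b ∈ B, G.Adj a b

def Saturated (G : SimpleGraph V) (A B : Set V) : Prop :=
  A = presat G A B ∧ B = presat G B A

def IsCompOf (G : SimpleGraph V) (W S : Set V) : Prop :=
  S.Nonempty ∧ S ⊆ W ∧ (G.induce S).Connected ∧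
    ∀ T, S ⊆ T → T ⊆ W → (G.induce T).Connected → T = S

def Eqv (G : SimpleGraph V) (A B : Set V) (u v : V) : Prop :=
  u = v ∨ ∃ L : List (Set V), L ≠ [] ∧
    (∀ S ∈ L, IsCompOf G (cnbhd G (A ∪ B))ᶜ S) ∧
    List.Chain' (fun S T => (nbhd G S ∩ nbhd G T).Nonempty) L ∧
    (∃ S₀ ∈ L.head?, u ∈ cnbhd G S₀) ∧
    (∃ Sₖ ∈ L.getLast?, v ∈ cnbhd G Sₖ)

end Paper

open Paper

namespace Paper

theorem induced_cons {G : SimpleGraph V} {u x v : V} (h : G.Adj u x) (q : G.Walk x v)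
    (hq : q.toSubgraph.IsInduced) (hn : ∀ t ∈ q.support, G.Adj u t → t = x) :
    (SimpleGraph.Walk.cons h q).toSubgraph.IsInduced := by
  intro s hs t ht hst
  simp only [SimpleGraph.Walk.mem_verts_toSubgraph, SimpleGraph.Walk.support_cons,
    List.mem_cons] at hs ht
  simp only [SimpleGraph.Walk.toSubgraph, SimpleGraph.Subgraph.sup_adj,
    SimpleGraph.subgraphOfAdj_adj]
  rcases hs with rfl | hs
  · rcases ht with rfl | ht
    · exact absurd hst (G.loopless.irrefl _)
    · left; rw [hn t ht hst]
  · rcases ht with rfl | ht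
    · left; rw [hn s hs hst.symm]; exact Sym2.eq_swap
    · right
      exact hq (by simpa using hs) (by simpa using ht) hst

theorem cons_induced {G : SimpleGraph V} {u x v : V} (h : G.Adj u x) (q : G.Walk x v)
    (hp : (SimpleGraph.Walk.cons h q).IsPath)
    (hi : (SimpleGraph.Walk.cons h q).toSubgraph.IsInduced) :
    ∀ t ∈ q.support, G.Adj u t → t = x := by
  intro t ht hut
  have hadj := hi (v := u) (w := t) (by simp) (by simp [ht]) hut
  simp only [SimpleGraph.Walk.toSubgraph, SimpleGraph.Subgraph.sup_adj,
    SimpleGraph.subgraphOfAdj_adj] at hadj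
  have hu : u ∉ q.support := ((SimpleGraph.Walk.cons_isPath_iff h q).1 hp).2
  rcases hadj with hadj | hadj
  · rcases Sym2.eq_iff.1 hadj with h1 | h1
    · exact h1.2.symm
    · exact absurd h1.2 h.ne'
  · exact absurd (by simpa using hadj.fst_mem) hu

theorem nil_induced (G : SimpleGraph V) (u : V) :
    (SimpleGraph.Walk.nil : G.Walk u u).toSubgraph.IsInduced := by
  intro s hs t ht hst
  simp at hs ht
  subst hs; subst ht
  exact absurd hst (G.loopless.irrefl _)

theorem exists_induced {G : SimpleGraph V} (n : ℕ) : ∀ {u v : V} (p : G.Walk u v),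
    p.length ≤ n → ∃ q : G.Walk u v, q.IsPath ∧ q.toSubgraph.IsInduced ∧
      ∀ t ∈ q.support, t ∈ p.support := by
  induction n with
  | zero =>
    intro u v p hp
    cases p with
    | nil => exact ⟨.nil, by simp, nil_induced G _, by simp⟩
    | cons h p => simp at hp
  | succ n ih =>
    intro u v p hp
    cases p with
    | nil => exact ⟨.nil, by simp, nil_induced G _, by simp⟩
    | @cons _ x _ h p =>
      simp only [SimpleGraph.Walk.length_cons, Nat.add_le_add_iff_right] at hp
      by_cases hu : u ∈ p.support
      · obtain ⟨q, h1, h2, h3⟩ := ih (p.dropUntil u hu) ((p.length_dropUntil_le_length hu).trans hp)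
        exact ⟨q, h1, h2, fun t ht => by
          simp [p.support_dropUntil_subset_support hu (h3 t ht)]⟩
      · by_cases ht : ∃ t ∈ p.support, G.Adj u t ∧ t ≠ x
        · obtain ⟨t, ht, hut, htx⟩ := ht
          have hlt : (p.dropUntil t ht).length < p.length := by
            have h1 := congrArg SimpleGraph.Walk.length (p.take_spec ht)
            rw [SimpleGraph.Walk.length_append] at h1
            have h2 : (p.takeUntil t ht).length ≠ 0 := fun h0 =>
              htx (SimpleGraph.Walk.eq_of_length_eq_zero h0).symm
            omega
          obtain ⟨q, h1, h2, h3⟩ := ih (.cons hut (p.dropUntil t ht)) (by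
            simp only [SimpleGraph.Walk.length_cons]; omega)
          refine ⟨q, h1, h2, fun s hs => ?_⟩
          have := h3 s hs
          simp only [SimpleGraph.Walk.support_cons, List.mem_cons] at this ⊢
          rcases this with h | h
          · exact Or.inl h
          · exact Or.inr (p.support_dropUntil_subset_support ht h)
        · push Not at ht
          obtain ⟨q, h1, h2, h3⟩ := ih p hp
          refine ⟨.cons h q, ?_, induced_cons h q h2 fun t h' => ht t (h3 t h'), ?_⟩
          · exact (SimpleGraph.Walk.cons_isPath_iff h q).2 ⟨h1, fun h' => hu (h3 _ h')⟩
          · intro s hs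
            simp only [SimpleGraph.Walk.support_cons, List.mem_cons] at hs ⊢
            exact hs.imp id (h3 s)

theorem mem_int2 {G : SimpleGraph V} {a w v : V} (h1 : G.Adj a w) (h2 : G.Adj w v)
    (h3 : ¬ G.Adj a v) (hav : a ≠ v) : w ∈ mInterval G a v := by
  refine ⟨.cons h1 (.cons h2 .nil), ?_, ?_, by simp⟩
  · simp [SimpleGraph.Walk.cons_isPath_iff, h1.ne, h2.ne, hav]
  · apply induced_cons
    · apply induced_cons
      · exact nil_induced G _
      · simp
    · intro t ht hat
      simp at ht
      rcases ht with rfl | rfl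
      · rfl
      · exact absurd hat h3

theorem mem_int3 {G : SimpleGraph V} {a w v u : V} (h1 : G.Adj a w) (h2 : G.Adj w v)
    (h3 : G.Adj v u) (hav : ¬ G.Adj a v) (hau : ¬ G.Adj a u) (hwu : ¬ G.Adj w u)
    (nav : a ≠ v) (nau : a ≠ u) (nwu : w ≠ u) : w ∈ mInterval G a u := by
  refine ⟨.cons h1 (.cons h2 (.cons h3 .nil)), ?_, ?_, by simp⟩
  · simp [SimpleGraph.Walk.cons_isPath_iff, h1.ne, h2.ne, h3.ne, nav, nau, nwu]
  · apply induced_cons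
    · apply induced_cons
      · apply induced_cons
        · exact nil_induced G _
        · simp
      · intro t ht hat
        simp at ht
        rcases ht with rfl | rfl
        · rfl
        · exact absurd hat hwu
    · intro t ht hat
      simp at ht
      rcases ht with rfl | rfl | rfl
      · rfl
      · exact absurd hat hav
      · exact absurd hat hau

theorem sub_hull (G : SimpleGraph V) (X : Set V) : X ⊆ mHull G X :=
  Set.subset_sInter fun _ h => h.2

theorem hull_convex (G : SimpleGraph V) (X : Set V) : MConvex G (mHull G X) := by
  intro u hu v hv w hw C hC
  exact hC.1 u (hu C hC) v (hv C hC) hw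

theorem hull_min {G : SimpleGraph V} {X C : Set V} (hC : MConvex G C) (h : X ⊆ C) :
    mHull G X ⊆ C := Set.sInter_subset_of_mem ⟨hC, h⟩

theorem singleton_convex (G : SimpleGraph V) (u : V) : MConvex G {u} := by
  rintro x rfl y hy w ⟨p, hp, -, hw⟩
  obtain rfl : y = x := hy
  have := (SimpleGraph.Walk.isPath_iff_eq_nil).1 hp
  subst this
  simpa using hw

/-- Neighbours inside `A`. -/
def NA (G : SimpleGraph V) (A : Set V) (v : V) : Set V := {a | a ∈ A ∧ G.Adj a v}

/-- One-sided consequences of saturation. -/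
structure Side (G : SimpleGraph V) (A B : Set V) : Prop where
  conv : MConvex G A
  sh : ∀ v ∉ A, ∀ z ∈ mHull G (B ∪ {v}), z ∉ A
  mfs : ∀ X ∈ MFS G A B, (⋂ x ∈ X, mHull G (A ∪ {x})) ⊆ A

theorem side_of {G : SimpleGraph V} {A B : Set V} (h : A = presat G A B) : Side G A B := by
  have h0 : (shadow G A B ∪ ⋃ X ∈ MFS G A B, ⋂ x ∈ X, mHull G (A ∪ {x})) ⊆ A := by
    conv_rhs => rw [h]
    exact sub_hull G _
  refine ⟨?_, ?_, ?_⟩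
  · rw [h]; exact hull_convex G _
  · intro v hv z hz hzA
    exact hv (h0 (Or.inl ⟨z, hz, hzA⟩))
  · intro X hX z hz
    exact h0 (Or.inr (Set.mem_biUnion hX hz))

theorem front_adj {G : SimpleGraph V} (hG : G.Connected) {A B : Set V} (hA : Side G A B)
    {a₀ b₀ a v : V} (ha₀ : a₀ ∈ A) (hb₀ : b₀ ∈ B) (hab : G.Adj a₀ b₀) (ha : a ∈ A)
    (hv : v ∉ A) (hvB : v ∉ B) (hva : G.Adj v a) : G.Adj v b₀ := by
  by_contra hn
  obtain ⟨p₀⟩ := hG.preconnected a a₀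
  obtain ⟨p, hp1, hp2, -⟩ := exists_induced _ p₀ le_rfl
  have hpA : ∀ t ∈ p.support, t ∈ A := fun t ht => hA.conv a ha a₀ ha₀ ⟨p, hp1, hp2, ht⟩
  obtain ⟨q, hq1, hq2, hq3⟩ := exists_induced _
    (SimpleGraph.Walk.cons hva (p.append (.cons hab .nil))) le_rfl
  have key : ∀ t ∈ q.support, t ∈ mHull G (B ∪ {v}) := fun t ht =>
    hull_convex G _ v (sub_hull G _ (by simp)) b₀ (sub_hull G _ (by simp [hb₀]))
      ⟨q, hq1, hq2, ht⟩
  have hvb : v ≠ b₀ := fun h => hvB (h ▸ hb₀)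
  cases q with
  | nil => exact hvb rfl
  | @cons _ y _ h q =>
    have hy : y ∈ (SimpleGraph.Walk.cons h q).support := by simp
    have h1 := hq3 y hy
    simp only [SimpleGraph.Walk.support_cons, List.mem_cons,
      SimpleGraph.Walk.mem_support_append_iff, SimpleGraph.Walk.support_nil,
      List.not_mem_nil, or_false] at h1
    have hyA : y ∈ A := by
      rcases h1 with h1 | h1 | h1 | h1
      · exact absurd h1 h.ne'
      · exact hpA y h1
      · exact h1 ▸ ha₀
      · exact absurd (h1 ▸ h) hn
    exact hA.sh v hv y (key y hy) hyA

theorem pair_mfs {G : SimpleGraph V} {A B : Set V} {a₀ b₀ u v : V} (ha₀ : a₀ ∈ A)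
    (hb₀ : b₀ ∈ B) (hu : u ∈ (A ∪ B)ᶜ) (hv : v ∈ (A ∪ B)ᶜ) (huv : u ≠ v) (hn : ¬ G.Adj u v)
    (h1 : G.Adj a₀ u) (h2 : G.Adj a₀ v) (h3 : G.Adj b₀ u) (h4 : G.Adj b₀ v) :
    {u, v} ∈ MFS G A B := by
  have hu' : u ∈ mHull G {u, v} := sub_hull G _ (by simp)
  have hv' : v ∈ mHull G {u, v} := sub_hull G _ (by simp)
  have aux : ∀ x ∈ (A ∪ B)ᶜ, ∀ Y ⊆ ({x} : Set V), ¬ Forbidden G A B Y := by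
    rintro x hx Y hY ⟨-, ⟨z, hz, hzA⟩, -⟩
    have : z = x := hull_min (singleton_convex G x) hY hz
    subst this
    exact hx (Or.inl hzA)
  refine ⟨⟨?_, ⟨a₀, ?_, ha₀⟩, ⟨b₀, ?_, hb₀⟩⟩, ?_⟩
  · rintro x (rfl | rfl) <;> assumption
  · exact hull_convex G _ u hu' v hv' (mem_int2 h1.symm h2 hn huv)
  · exact hull_convex G _ u hu' v hv' (mem_int2 h3.symm h4 hn huv)
  · intro Y hY
    by_cases huY : u ∈ Y
    · apply aux u hu
      intro y hy
      rcases hY.1 hy with h | h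
      · exact h
      · exfalso
        obtain rfl : y = v := h
        apply hY.2
        rintro x (rfl | rfl) <;> assumption
    · apply aux v hv
      intro y hy
      rcases hY.1 hy with h | h
      · exact absurd (h ▸ hy) huY
      · exact h

/-- All one-sided data, including the vertex `b₀` of `B` adjacent to everything. -/
structure Full (G : SimpleGraph V) (A B : Set V) : Prop where
  side : Side G A B
  shB : ∀ v ∉ B, ∀ z ∈ mHull G (A ∪ {v}), z ∉ B
  b : ∃ b₀ ∈ B, ∀ v ∈ (A ∪ B)ᶜ, G.Adj b₀ v
  mf : ∀ u ∈ (A ∪ B)ᶜ, ∀ v ∈ (A ∪ B)ᶜ, u ≠ v → ¬ G.Adj u v →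
    ∀ z ∈ (A ∪ B)ᶜ, z ∈ mHull G (A ∪ {u}) → z ∉ mHull G (A ∪ {v})

theorem Full.F2 {G : SimpleGraph V} {A B : Set V} (h : Full G A B) :
    ∀ u ∈ (A ∪ B)ᶜ, ∀ v ∈ (A ∪ B)ᶜ, ∀ w ∈ (A ∪ B)ᶜ, u ≠ v → ¬ G.Adj u v → G.Adj v w →
      G.Adj u w → NA G A w ⊆ NA G A v ∨ NA G A w ⊆ NA G A u := by
  intro u hu v hv w hw huv hn hvw huw
  by_contra hc
  simp only [not_or, Set.not_subset] at hc
  obtain ⟨⟨a, ⟨ha, haw⟩, hav⟩, ⟨a', ⟨ha', haw'⟩, hau⟩⟩ := hc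
  refine h.mf u hu v hv huv hn w hw ?_ ?_
  · refine hull_convex G _ a' (sub_hull G _ (Or.inl ha')) u (sub_hull G _ (by simp))
      (mem_int2 haw' huw.symm (fun h' => hau ⟨ha', h'⟩) ?_)
    rintro rfl; exact hu (Or.inl ha')
  · refine hull_convex G _ a (sub_hull G _ (Or.inl ha)) v (sub_hull G _ (by simp))
      (mem_int2 haw hvw.symm (fun h' => hav ⟨ha, h'⟩) ?_)
    rintro rfl; exact hv (Or.inl ha)

theorem Full.F1 {G : SimpleGraph V} {A B : Set V} (h : Full G A B) :
    ∀ u ∈ (A ∪ B)ᶜ, ∀ v ∈ (A ∪ B)ᶜ, ∀ w ∈ (A ∪ B)ᶜ, G.Adj v w → u ≠ w → ¬ G.Adj u w →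
      ¬ NA G A w ⊆ NA G A v → ¬ G.Adj u v := by
  intro u hu v hv w hw hvw huw hn hs huv
  obtain ⟨a, ⟨ha, haw⟩, hav⟩ := Set.not_subset.1 hs
  have hav : ¬ G.Adj a v := fun h' => hav ⟨ha, h'⟩
  have ne : ∀ x ∈ (A ∪ B)ᶜ, a ≠ x := by rintro x hx rfl; exact hx (Or.inl ha)
  by_cases hau : G.Adj a u
  · obtain ⟨b₀, hb₀, hb⟩ := h.b
    have c := hull_convex G (A ∪ {v})
    have haH : a ∈ mHull G (A ∪ {v}) := sub_hull G _ (Or.inl ha)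
    have hvH : v ∈ mHull G (A ∪ {v}) := sub_hull G _ (by simp)
    have huH := c a haH v hvH (mem_int2 hau huv hav (ne v hv))
    have hwH := c a haH v hvH (mem_int2 haw hvw.symm hav (ne v hv))
    exact h.shB v (fun h' => hv (Or.inr h')) b₀
      (c u huH w hwH (mem_int2 (hb u hu).symm (hb w hw) hn huw)) hb₀
  · refine h.mf u hu w hw huw hn w hw ?_ (sub_hull G _ (by simp))
    exact hull_convex G _ a (sub_hull G _ (Or.inl ha)) u (sub_hull G _ (by simp))
      (mem_int3 haw hvw.symm huv.symm hav hau (fun h' => hn h'.symm) (ne v hv) (ne u hu)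
        huw.symm)

theorem mint_symm {G : SimpleGraph V} {x y z : V} (h : z ∈ mInterval G x y) :
    z ∈ mInterval G y x := by
  obtain ⟨p, h1, h2, h3⟩ := h
  exact ⟨p.reverse, h1.reverse, by simpa using h2, by simpa using h3⟩

theorem Full.conv {G : SimpleGraph V} {A B : Set V} (h : Full G A B) {K : Set V}
    (hK : K ⊆ (A ∪ B)ᶜ) (hc : IsClique G K)
    (hcl : ∀ v ∈ K, ∀ w ∈ (A ∪ B)ᶜ, G.Adj v w → ¬ NA G A w ⊆ NA G A v → w ∈ K) :
    MConvex G (A ∪ K) := by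
  have main : ∀ y ∈ K, ∀ x ∈ A, ∀ z ∈ mInterval G y x, z ∈ A ∪ K := by
    rintro y hy x hx z ⟨p, hp, hi, hz⟩
    by_contra hzC
    have hyR := hK hy
    have key : ∀ t ∈ p.support, t ∈ mHull G (A ∪ {y}) := fun t ht =>
      hull_convex G _ y (sub_hull G _ (by simp)) x (sub_hull G _ (by simp [hx]))
        ⟨p, hp, hi, ht⟩
    have keyB : ∀ t ∈ p.support, t ∉ B := fun t ht =>
      h.shB y (fun h' => hyR (Or.inr h')) t (key t ht)
    have keyR : ∀ t ∈ p.support, t ∉ A → t ≠ y → G.Adj y t := by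
      intro t ht htA hty
      have htR : t ∈ (A ∪ B)ᶜ := fun h' => h'.elim htA (keyB t ht)
      by_contra hn
      exact h.mf y hyR t htR hty.symm hn t htR (key t ht) (sub_hull G _ (by simp))
    have hzA : z ∉ A := fun h' => hzC (Or.inl h')
    have hzy : z ≠ y := by rintro rfl; exact hzC (Or.inr hy)
    have hzx : z ≠ x := by rintro rfl; exact hzA hx
    have hzR : z ∈ (A ∪ B)ᶜ := fun h' => h'.elim hzA (keyB z hz)
    have hyz := keyR z hz hzA hzy
    cases p with
    | nil => exact hyR (Or.inl hx)
    | @cons _ z' _ h1 q =>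
      have c := cons_induced h1 q hp hi
      have hzq : z ∈ q.support := by
        simpa [hzy] using hz
      obtain rfl := c z hzq hyz
      cases q with
      | nil => exact hzx rfl
      | @cons _ s _ h2 q =>
        have hsq : s ∈ (SimpleGraph.Walk.cons h2 q).support := by simp
        have hs : s ∈ (SimpleGraph.Walk.cons h1 (SimpleGraph.Walk.cons h2 q)).support := by
          simp
        have hys : ¬ G.Adj y s := fun h' => h2.ne' (c s hsq h')
        have hsy : s ≠ y := by
          rintro rfl
          exact ((SimpleGraph.Walk.cons_isPath_iff _ _).1 hp).2 hsq
        have hsA : s ∈ A := by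
          by_contra h'
          exact hys (keyR s hs h' hsy)
        exact hzC (Or.inr (hcl y hy z hzR hyz fun h' => hys (h' ⟨hsA, h2.symm⟩).2.symm))
  rintro x (hx | hx) y (hy | hy) z hz
  · exact Or.inl (h.side.conv x hx y hy hz)
  · exact main y hy x hx z (mint_symm hz)
  · exact main x hx y hy z hz
  · obtain ⟨p, hp, hi, hz⟩ := hz
    by_cases hxy : x = y
    · subst hxy
      have := (SimpleGraph.Walk.isPath_iff_eq_nil).1 hp
      subst this
      simp at hz
      exact Or.inr (hz ▸ hx)
    · cases p with
      | nil => exact absurd rfl hxy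
      | @cons _ z' _ h1 q =>
        obtain rfl := cons_induced h1 q hp hi y (by simp) (hc x hx y hy hxy)
        have := (SimpleGraph.Walk.isPath_iff_eq_nil).1
          ((SimpleGraph.Walk.cons_isPath_iff _ _).1 hp).1
        subst this
        simp at hz
        rcases hz with rfl | rfl
        · exact Or.inr hx
        · exact Or.inr hy

/-- Axioms of the combinatorial core. -/
structure Core (G : SimpleGraph V) (R : Set V) (N : V → Set V) : Prop where
  F1 : ∀ u ∈ R, ∀ v ∈ R, ∀ w ∈ R, G.Adj v w → u ≠ w → ¬ G.Adj u w →
      ¬ N w ⊆ N v → ¬ G.Adj u v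
  F2 : ∀ u ∈ R, ∀ v ∈ R, ∀ w ∈ R, u ≠ v → ¬ G.Adj u v → G.Adj v w →
      G.Adj u w → N w ⊆ N v ∨ N w ⊆ N u

def Univ (G : SimpleGraph V) (R : Set V) (w : V) : Prop := ∀ u ∈ R, u ≠ w → G.Adj u w

theorem not_univ {G : SimpleGraph V} {R : Set V} {w : V} (h : ¬ Univ G R w) :
    ∃ u ∈ R, u ≠ w ∧ ¬ G.Adj u w := by
  simpa [Univ] using h

theorem Core.sub {G : SimpleGraph V} {R : Set V} {N : V → Set V} (h : Core G R N)
    {v w : V} (hv : v ∈ R) (hw : w ∈ R) (hw' : Univ G R w) (hv' : ¬ Univ G R v) :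
    N v ⊆ N w := by
  by_contra hc
  obtain ⟨u, hu, huv, hn⟩ := not_univ hv'
  have hvw : v ≠ w := by rintro rfl; exact hv' hw'
  have h1 := h.F1 u hu w hw v hv (hw' v hv hvw).symm huv hn hc
  have : u = w := by
    by_contra h'
    exact h1 (hw' u hu h')
  subst this
  exact hn (hw' v hv hvw).symm

/-- Conflict. -/
def Confl (G : SimpleGraph V) (R : Set V) (N M : V → Set V) (v v' w : V) : Prop :=
  ¬ Univ G R v ∧ ¬ Univ G R v' ∧ w ∈ R ∧ Univ G R w ∧ ¬ N w ⊆ N v ∧ ¬ M w ⊆ M v'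

theorem confl_nonadj {G : SimpleGraph V} {R : Set V} {N M : V → Set V} (hN : Core G R N)
    {K₁ K₂ : Set V} (hR : K₁ ∪ K₂ = R) (hd : Disjoint K₁ K₂)
    (h1 : IsClique G K₁) (h2 : IsClique G K₂) {v v' w : V} (hv : v ∈ K₁) (hv' : v' ∈ K₂)
    (hc : Confl G R N M v v' w) : ¬ G.Adj v v' := by
  intro hadj
  obtain ⟨nv, nv', hw, uw, n1, n2⟩ := hc
  have r1 : ∀ x ∈ K₁, x ∈ R := fun x hx => hR ▸ Or.inl hx
  have r2 : ∀ x ∈ K₂, x ∈ R := fun x hx => hR ▸ Or.inr hx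
  have s1 : N v' ⊆ N v := by
    by_contra hs
    obtain ⟨u, hu, huv, hn⟩ := not_univ nv'
    have := hN.F1 u hu v (r1 v hv) v' (r2 v' hv') hadj huv hn hs
    rw [← hR] at hu
    rcases hu with hu | hu
    · refine this (h1 u hu v hv ?_)
      rintro rfl; exact hn hadj
    · exact hn (h2 u hu v' hv' huv)
  obtain ⟨u, hu, huv, hn⟩ := not_univ nv
  have huK : u ∈ K₂ := by
    rcases (hR.symm ▸ hu : u ∈ K₁ ∪ K₂) with h | h
    · exact absurd (h1 u h v hv huv) hn
    · exact h
  have huv' : u ≠ v' := by rintro rfl; exact hn hadj.symm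
  have hvw : v ≠ w := by rintro rfl; exact nv uw
  have huw : u ≠ w := by rintro rfl; exact hn (uw v (r1 v hv) hvw).symm
  have s2 : N w ⊆ N u := (hN.F2 u hu v (r1 v hv) w hw huv hn (uw v (r1 v hv) hvw)
    (uw u hu huw)).resolve_left n1
  exact hN.F1 v (r1 v hv) v' (r2 v' hv') u hu (h2 u huK v' hv' huv').symm huv.symm
    (fun h => hn h.symm) (fun h => n1 (s2.trans (h.trans s1))) hadj

theorem no_double {G : SimpleGraph V} {R : Set V} {N M : V → Set V} (hN : Core G R N)
    (hM : Core G R M)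
    {K₁ K₂ : Set V} (hR : K₁ ∪ K₂ = R) (hd : Disjoint K₁ K₂)
    (h1 : IsClique G K₁) (h2 : IsClique G K₂) {v v' w t t' z : V} (hv : v ∈ K₁)
    (hv' : v' ∈ K₂) (hc : Confl G R N M v v' w) (ht : t ∈ K₂) (ht' : t' ∈ K₁)
    (hc' : Confl G R N M t t' z) : False := by
  have a1 := confl_nonadj hN hR hd h1 h2 hv hv' hc
  have a2 := confl_nonadj hN (by rw [Set.union_comm]; exact hR) hd.symm h2 h1 ht ht' hc'
  obtain ⟨nv, nv', hw, uw, n1, n2⟩ := hc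
  obtain ⟨nt, nt', hz, uz, m1, m2⟩ := hc'
  have r1 : ∀ x ∈ K₁, x ∈ R := fun x hx => hR ▸ Or.inl hx
  have r2 : ∀ x ∈ K₂, x ∈ R := fun x hx => hR ▸ Or.inr hx
  have dis : ∀ x ∈ K₁, ∀ y ∈ K₂, x ≠ y := by
    rintro x hx y hy rfl; exact Set.disjoint_left.1 hd hx hy
  have au : ∀ x, ¬ Univ G R x → x ∈ R → ∀ y, Univ G R y → G.Adj x y := by
    intro x hx hxR y hy
    exact hy x hxR (by rintro rfl; exact hx hy)
  have e1 : M w ⊆ M v := (hM.F2 v (r1 v hv) v' (r2 v' hv') w hw (dis v hv v' hv') a1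
    (au v' nv' (r2 _ hv') w uw) (au v nv (r1 _ hv) w uw)).resolve_left n2
  have e2 : M z ⊆ M t := (hM.F2 t (r2 t ht) t' (r1 t' ht') z hz (dis t' ht' t ht).symm a2
    (au t' nt' (r1 _ ht') z uz) (au t nt (r2 _ ht) z uz)).resolve_left m2
  have e3 : M t ⊆ M w := hM.sub (r2 t ht) hw uw nt
  have e4 : M v ⊆ M z := hM.sub (r1 v hv) hz uz nv
  have hadj : G.Adj t' v' := by
    by_contra hn
    rcases hM.F2 t' (r1 _ ht') v' (r2 _ hv') w hw (dis _ ht' _ hv') hn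
      (au v' nv' (r2 _ hv') w uw) (au t' nt' (r1 _ ht') w uw) with h | h
    · exact n2 h
    · exact m2 ((e2.trans e3).trans h)
  have hn : ¬ M v ⊆ M t' := fun h => m2 ((e2.trans e3).trans (e1.trans h))
  have hvt : v ≠ t' := by rintro rfl; exact hn subset_rfl
  exact hM.F1 v' (r2 _ hv') t' (r1 _ ht') v (r1 _ hv) (h1 v hv t' ht' hvt).symm
    (dis v hv v' hv').symm (fun h => a1 h.symm) hn hadj.symm

theorem core_aux {G : SimpleGraph V} {R : Set V} {N M : V → Set V} (hN : Core G R N)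
    (hM : Core G R M)
    {K₁ K₂ : Set V} (hR : K₁ ∪ K₂ = R) (hd : Disjoint K₁ K₂)
    (h1 : IsClique G K₁) (h2 : IsClique G K₂)
    (hno : ∀ v ∈ K₁, ∀ v' ∈ K₂, ∀ w, ¬ Confl G R N M v v' w) :
    ∃ K ⊆ R, IsClique G K ∧ IsClique G (R \ K) ∧
      (∀ v ∈ K, ∀ w ∈ R, G.Adj v w → ¬ N w ⊆ N v → w ∈ K) ∧
      (∀ v ∈ R \ K, ∀ w ∈ R, G.Adj v w → ¬ M w ⊆ M v → w ∈ R \ K) := by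
  have r1 : ∀ x ∈ K₁, x ∈ R := fun x hx => hR ▸ Or.inl hx
  have r2 : ∀ x ∈ K₂, x ∈ R := fun x hx => hR ▸ Or.inr hx
  have dis : ∀ x ∈ K₁, x ∉ K₂ := fun x hx => Set.disjoint_left.1 hd hx
  have r3 : ∀ x ∈ R, x ∈ K₁ ∨ x ∈ K₂ := fun x hx => by rw [← hR] at hx; exact hx
  -- nonuniversal vertices move together
  have move : ∀ N', Core G R N' → ∀ v ∈ R, ∀ w ∈ R, G.Adj v w → ¬ N' w ⊆ N' v →
      ¬ Univ G R w → ¬ Univ G R v ∧ (v ∈ K₁ ↔ w ∈ K₁) := by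
    intro N' h' v hv w hw hvw hs hnw
    obtain ⟨u, hu, huw, hn⟩ := not_univ hnw
    have hnv := h'.F1 u hu v hv w hw hvw huw hn hs
    have huv : u ≠ v := by rintro rfl; exact hn hvw
    refine ⟨fun h => hnv (h u hu huv), ?_⟩
    have c1 := h1 u
    have c2 := h2 u
    constructor
    · intro hv1
      rcases r3 w hw with h | h
      · exact h
      · rcases r3 u hu with h3 | h3
        · exact absurd (h1 u h3 v hv1 huv) hnv
        · exact absurd (h2 u h3 w h huw) hn
    · intro hv1
      rcases r3 v hv with h | h
      · exact h
      · rcases r3 u hu with h3 | h3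
        · exact absurd (h1 u h3 w hv1 huw) hn
        · exact absurd (h2 u h3 v h huv) hnv
  let K : Set V := {x | x ∈ R ∧ ((¬ Univ G R x ∧ x ∈ K₁) ∨
    (Univ G R x ∧ ∃ v ∈ K₁, ¬ Univ G R v ∧ ¬ N x ⊆ N v))}
  refine ⟨K, fun x hx => hx.1, ?_, ?_, ?_, ?_⟩
  · rintro x ⟨hx, hx'⟩ y ⟨hy, hy'⟩ hxy
    rcases hy' with ⟨-, hy'⟩ | ⟨hy', -⟩
    · rcases hx' with ⟨-, hx'⟩ | ⟨hx', -⟩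
      · exact h1 x hx' y hy' hxy
      · exact (hx' y hy hxy.symm).symm
    · exact hy' x hx hxy
  · rintro x ⟨hx, hx'⟩ y ⟨hy, hy'⟩ hxy
    by_cases ux : Univ G R x
    · exact (ux y hy hxy.symm).symm
    by_cases uy : Univ G R y
    · exact uy x hx hxy
    have hx2 := (r3 x hx).resolve_left fun h => hx' ⟨hx, Or.inl ⟨ux, h⟩⟩
    have hy2 := (r3 y hy).resolve_left fun h => hy' ⟨hy, Or.inl ⟨uy, h⟩⟩
    exact h2 x hx2 y hy2 hxy
  · rintro v ⟨hv, hv'⟩ w hw hvw hs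
    refine ⟨hw, ?_⟩
    by_cases uw : Univ G R w
    · right
      refine ⟨uw, ?_⟩
      rcases hv' with ⟨uv, hv1⟩ | ⟨uv, v0, hv0, uv0, -⟩
      · exact ⟨v, hv1, uv, hs⟩
      · exact ⟨v0, hv0, uv0, fun h => hs (h.trans (hN.sub (r1 _ hv0) hv uv uv0))⟩
    · left
      obtain ⟨uv, hiff⟩ := move N hN v hv w hw hvw hs uw
      refine ⟨uw, hiff.1 ?_⟩
      rcases hv' with ⟨-, h⟩ | ⟨h, -⟩
      · exact h
      · exact absurd h uv
  · rintro v ⟨hv, hv'⟩ w hw hvw hs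
    refine ⟨hw, ?_⟩
    rintro ⟨-, ⟨uw, hw1⟩ | ⟨uw, v1, hv1, uv1, hs1⟩⟩
    · obtain ⟨uv, hiff⟩ := move M hM v hv w hw hvw hs uw
      exact hv' ⟨hv, Or.inl ⟨uv, hiff.2 hw1⟩⟩
    · by_cases uv : Univ G R v
      · obtain ⟨u, hu, huv, hn⟩ := not_univ uv1
        have hu2 : u ∈ K₂ := (r3 u hu).resolve_left fun h => hn (h1 u h v1 hv1 huv)
        have uu : ¬ Univ G R u := fun h => hn (h v1 (r1 _ hv1) huv.symm).symm
        exact hno v1 hv1 u hu2 w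
          ⟨uv1, uu, hw, uw, hs1, fun h => hs (h.trans (hM.sub hu hv uv uu))⟩
      · have hv2 : v ∈ K₂ := (r3 v hv).resolve_left fun h => hv' ⟨hv, Or.inl ⟨uv, h⟩⟩
        exact hno v1 hv1 v hv2 w ⟨uv1, uv, hw, uw, hs1, hs⟩

theorem core_main {G : SimpleGraph V} {R : Set V} {N M : V → Set V} (hN : Core G R N)
    (hM : Core G R M)
    {K₁ K₂ : Set V} (hR : K₁ ∪ K₂ = R) (hd : Disjoint K₁ K₂)
    (h1 : IsClique G K₁) (h2 : IsClique G K₂) :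
    ∃ K ⊆ R, IsClique G K ∧ IsClique G (R \ K) ∧
      (∀ v ∈ K, ∀ w ∈ R, G.Adj v w → ¬ N w ⊆ N v → w ∈ K) ∧
      (∀ v ∈ R \ K, ∀ w ∈ R, G.Adj v w → ¬ M w ⊆ M v → w ∈ R \ K) := by
  by_cases hno : ∀ v ∈ K₁, ∀ v' ∈ K₂, ∀ w, ¬ Confl G R N M v v' w
  · exact core_aux hN hM hR hd h1 h2 hno
  · push Not at hno
    obtain ⟨v, hv, v', hv', w, hc⟩ := hno
    refine core_aux hN hM (by rw [Set.union_comm]; exact hR) hd.symm h2 h1 ?_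
    intro t ht t' ht' z hc'
    exact no_double hN hM hR hd h1 h2 hv hv' hc ht ht' hc'

end Paper

open Paper

theorem stmt_15 [Fintype V] (G : SimpleGraph V) (hG : G.Connected)
    (A B : Set V) (hL : Linked G A B) (hd : Disjoint A B)
    (hS : Saturated G A B) (hall : (A ∪ B)ᶜ = nbhd G (A ∪ B)) :
    Sep G A B ↔ ∃ K₁ K₂ : Set V, K₁ ∪ K₂ = nbhd G (A ∪ B) ∧ Disjoint K₁ K₂ ∧
      IsClique G K₁ ∧ IsClique G K₂ := by
  obtain ⟨a₀, ha₀, b₀, hb₀, hab⟩ := hL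
  have sA := side_of hS.1
  have sB := side_of hS.2
  have adj : ∀ v ∈ (A ∪ B)ᶜ, G.Adj a₀ v ∧ G.Adj b₀ v := by
    intro v hv
    have hvA : v ∉ A := fun h => hv (Or.inl h)
    have hvB : v ∉ B := fun h => hv (Or.inr h)
    have fA : ∀ a ∈ A, G.Adj v a → G.Adj v b₀ := fun a ha h =>
      front_adj hG sA ha₀ hb₀ hab ha hvA hvB h
    have fB : ∀ b ∈ B, G.Adj v b → G.Adj v a₀ := fun b hb h =>
      front_adj hG sB hb₀ ha₀ hab.symm hb hvB hvA h
    have hv' := hv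
    rw [hall] at hv'
    obtain ⟨-, x, hx | hx, hxv⟩ := hv'
    · have h1 := fA x hx hxv.symm
      exact ⟨(fB b₀ hb₀ h1).symm, h1.symm⟩
    · have h1 := fB x hx hxv.symm
      exact ⟨h1.symm, (fA a₀ ha₀ h1).symm⟩
  rw [← hall]
  constructor
  · rintro ⟨H, hH, hH', hAH, hBH⟩
    refine ⟨H ∩ (A ∪ B)ᶜ, Hᶜ ∩ (A ∪ B)ᶜ, ?_, ?_, ?_, ?_⟩
    · rw [← Set.union_inter_distrib_right, Set.union_compl_self, Set.univ_inter]
    · exact Set.disjoint_left.2 fun x hx hx' => hx'.1 hx.1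
    · intro u hu v hv huv
      by_contra hn
      exact hBH hb₀ (hH u hu.1 v hv.1 (mem_int2 (adj u hu.2).2.symm (adj v hv.2).2 hn huv))
    · intro u hu v hv huv
      by_contra hn
      exact hH' u hu.1 v hv.1 (mem_int2 (adj u hu.2).1.symm (adj v hv.2).1 hn huv) (hAH ha₀)
  · rintro ⟨K₁, K₂, hR, hdis, h1, h2⟩
    have hcomm : B ∪ A = A ∪ B := Set.union_comm _ _
    have fA : Full G A B := by
      refine ⟨sA, sB.sh, ⟨b₀, hb₀, fun v hv => (adj v hv).2⟩, ?_⟩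
      intro u hu v hv huv hn z hz hzu hzv
      refine hz (Or.inl (sA.mfs {u, v} (pair_mfs ha₀ hb₀ hu hv huv hn (adj u hu).1 (adj v hv).1
        (adj u hu).2 (adj v hv).2) ?_))
      exact Set.mem_iInter₂.2 (by rintro x (rfl | rfl) <;> assumption)
    have fB : Full G B A := by
      refine ⟨sB, sA.sh, ⟨a₀, ha₀, fun v hv => (adj v (hcomm ▸ hv)).1⟩, ?_⟩
      intro u hu v hv huv hn z hz hzu hzv
      have hu' := hcomm ▸ hu
      have hv' := hcomm ▸ hv
      refine hz (Or.inl (sB.mfs {u, v} (pair_mfs hb₀ ha₀ hu hv huv hn (adj u hu').2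
        (adj v hv').2 (adj u hu').1 (adj v hv').1) ?_))
      exact Set.mem_iInter₂.2 (by rintro x (rfl | rfl) <;> assumption)
    have cA : Core G (A ∪ B)ᶜ (NA G A) := ⟨fA.F1, fA.F2⟩
    have cB : Core G (A ∪ B)ᶜ (NA G B) := by
      rw [← hcomm]; exact ⟨fB.F1, fB.F2⟩
    obtain ⟨K, hK, k1, k2, k3, k4⟩ := core_main cA cB hR hdis h1 h2
    have hcompl : (A ∪ K)ᶜ = B ∪ ((A ∪ B)ᶜ \ K) := by
      ext x
      have e1 : x ∈ A → x ∉ B := fun h => Set.disjoint_left.1 hd h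
      have e2 : x ∈ K → x ∉ A ∧ x ∉ B := fun h => by simpa using hK h
      simp only [Set.mem_compl_iff, Set.mem_union, Set.mem_sdiff]
      tauto
    refine ⟨A ∪ K, fA.conv hK k1 k3, ?_, Set.subset_union_left, ?_⟩
    · rw [hcompl]
      refine fB.conv ?_ k2 ?_
      · rw [hcomm]; exact Set.sdiff_subset
      · rw [hcomm]; exact k4
    · rw [hcompl]; exact Set.subset_union_left
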